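/- arXiv:1703.03190 — 10 statements merged into one kernel-verified Lean document; each statement's English description precedes it below -/
import Mathlib

section
/- Let G be a complete bipartite graph with bipartition (V1, V2), where V1 and V2 are both nonempty and every vertex of V1 is adjacent to every vertex of V2 (and these are the only edges). Then every maximal independent set of G is robust, i.e., it remains a maximal independent set in every connected spanning subgraph of G. -/
/-- A set of vertices is independent in `G` if no two of its members are adjacent. -/
def IsIndep {V : Type*} (G : SimpleGraph V) (M : Set V) : Prop :=
  ∀ ⦃u⦄, u ∈ M → ∀ ⦃v⦄, v ∈ M → ¬ G.Adj u v

/-- A maximal independent set of `G`: independent and maximal w.r.t. inclusion among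
independent sets of `G`. -/
def IsMIS {V : Type*} (G : SimpleGraph V) (M : Set V) : Prop :=
  IsIndep G M ∧ ∀ S : Set V, IsIndep G S → M ⊆ S → S = M

/-- A robust MIS of `G`: an MIS of `G` that remains a maximal independent set in every
connected spanning subgraph of `G` (a spanning subgraph being a graph on the same vertex
set whose edge set is contained in that of `G`). -/
def IsRobustMIS {V : Type*} (G : SimpleGraph V) (M : Set V) : Prop :=
  IsMIS G M ∧ ∀ H : SimpleGraph V, H ≤ G → H.Connected → IsMIS H M

theorem IsIndep.isMIS_of_dominating {V : Type*} {G : SimpleGraph V} {M : Set V}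
    (hM : IsIndep G M) (hdom : ∀ x, x ∉ M → ∃ y ∈ M, G.Adj x y) : IsMIS G M := by
  refine ⟨hM, fun S hS hMS => Set.Subset.antisymm (fun x hx => ?_) hMS⟩
  by_contra hxM
  obtain ⟨y, hy, hxy⟩ := hdom x hxM
  exact hS hx (hMS hy) hxy

/-- If every edge of `G` joins `A` to its complement and `A` is neither empty nor everything,
then a maximal independent set contained in `A` is robust. -/
theorem IsMIS.isRobustMIS_of_subset {V : Type*} {G : SimpleGraph V} {A M : Set V}
    (hA : A.Nonempty) (hAc : Aᶜ.Nonempty) (hG : ∀ u v, G.Adj u v → (u ∈ A ↔ v ∉ A))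
    (hM : IsMIS G M) (hMA : M ⊆ A) : IsRobustMIS G M := by
  have hind : IsIndep G A := fun u hu v hv huv => (hG u v huv).1 hu hv
  obtain rfl : A = M := hM.2 A hind hMA
  refine ⟨hM, fun H hle hconn => ?_⟩
  have hHind : IsIndep H A := fun u hu v hv huv => hind hu hv (hle huv)
  refine hHind.isMIS_of_dominating fun x hx => ?_
  obtain ⟨a, ha⟩ := hA
  obtain ⟨b, hb⟩ := hAc
  have : Nontrivial V := ⟨a, b, fun h => hb (h ▸ ha)⟩
  obtain ⟨y, hxy⟩ := hconn.preconnected.exists_adj_of_nontrivial x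
  exact ⟨y, not_not.1 fun hy => hx ((hG x y (hle hxy)).2 hy), hxy⟩

/-- In a complete bipartite graph (both parts nonempty, every vertex of `V1`
adjacent to every vertex of `V2`, and no other edges), every maximal independent set is
robust. -/
theorem stmt_0 {V : Type*} (G : SimpleGraph V) (V1 V2 : Set V)
    (h1 : V1.Nonempty) (h2 : V2.Nonempty)
    (hdisj : V1 ∩ V2 = ∅) (hcover : V1 ∪ V2 = Set.univ)
    (hadj : ∀ u v, G.Adj u v ↔ ((u ∈ V1 ∧ v ∈ V2) ∨ (u ∈ V2 ∧ v ∈ V1)))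
    (M : Set V) (hM : IsMIS G M) :
    IsRobustMIS G M := by
  have hV2 : V1ᶜ = V2 :=
    (IsCompl.of_eq hdisj hcover).compl_eq
  subst hV2
  have hG : ∀ u v, G.Adj u v → (u ∈ V1 ↔ v ∉ V1) := fun u v huv => by
    have := (hadj u v).1 huv
    simp only [Set.mem_compl_iff] at this
    tauto
  by_cases hMV : M ⊆ V1
  · exact hM.isRobustMIS_of_subset h1 h2 hG hMV
  · obtain ⟨v, hvM, hv⟩ := Set.not_subset.1 hMV
    refine hM.isRobustMIS_of_subset h2 (by rwa [compl_compl]) (fun a b hab => ?_)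
      fun u huM hu => hM.1 huM hvM ((hadj u v).2 (Or.inl ⟨hu, hv⟩))
    simpa only [Set.mem_compl_iff] using not_congr (hG a b hab)
end

section
/- Let G be a connected sputnik graph, i.e., a connected simple graph in which every vertex lying on a cycle has a pendant neighbor. Then every maximal independent set of G is robust, i.e., it remains a maximal independent set in every connected spanning subgraph of G. -/
/-- A vertex is pendant if it has degree 1, i.e. exactly one neighbor. -/
def IsPendant {V : Type*} (G : SimpleGraph V) (v : V) : Prop :=
  ∃! u, G.Adj v u

/-- A vertex lies on a cycle of `G`. -/
def OnCycle {V : Type*} (G : SimpleGraph V) (v : V) : Prop :=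
  ∃ (u : V) (w : G.Walk u u), w.IsCycle ∧ v ∈ w.support

/-- A sputnik: every vertex lying on a cycle has a pendant neighbor. -/
def IsSputnik {V : Type*} (G : SimpleGraph V) : Prop :=
  ∀ v : V, OnCycle G v → ∃ u, G.Adj v u ∧ IsPendant G u

/-- A complete bipartite graph: the vertices can be partitioned into two nonempty sets
`V1` and `V2` with every vertex of `V1` adjacent to every vertex of `V2`, and these are
the only edges. -/
def IsCompleteBipartite {V : Type*} (G : SimpleGraph V) : Prop :=
  ∃ V1 V2 : Set V, V1.Nonempty ∧ V2.Nonempty ∧ V1 ∩ V2 = ∅ ∧ V1 ∪ V2 = Set.univ ∧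
    ∀ u v, G.Adj u v ↔ ((u ∈ V1 ∧ v ∈ V2) ∨ (u ∈ V2 ∧ v ∈ V1))

theorem isMIS_iff {V : Type*} {G : SimpleGraph V} {M : Set V} :
    IsMIS G M ↔ IsIndep G M ∧ ∀ v ∉ M, ∃ w ∈ M, G.Adj v w := by
  refine ⟨fun ⟨hind, hmax⟩ => ⟨hind, fun v hv => ?_⟩, fun ⟨hind, hdom⟩ => ⟨hind, ?_⟩⟩
  · by_contra! hno
    refine hv (hmax (insert v M) ?_ (Set.subset_insert v M) ▸ Set.mem_insert v M)
    rintro a (rfl | ha) b (rfl | hb) hab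
    · exact hab.ne rfl
    · exact hno b hb hab
    · exact hno a ha hab.symm
    · exact hind ha hb hab
  · intro S hS hMS
    refine Set.Subset.antisymm (fun v hvS => ?_) hMS
    by_contra hvM
    obtain ⟨w, hw, hvw⟩ := hdom v hvM
    exact hS hvS (hMS hw) hvw

theorem onCycle_of_adj_of_not_adj {V : Type*} {G H : SimpleGraph V} (hHG : H ≤ G)
    (hH : H.Connected) {v w : V} (hG : G.Adj v w) (hvw : ¬ H.Adj v w) : OnCycle G v := by
  have hle : H ≤ G.deleteEdges {s(v, w)} := by
    intro a b hab
    refine SimpleGraph.deleteEdges_adj.2 ⟨hHG hab, fun h => hvw ?_⟩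
    rw [Set.mem_singleton_iff] at h
    rwa [← SimpleGraph.mem_edgeSet, ← h]
  obtain ⟨u, p, hp, hmem⟩ := SimpleGraph.adj_and_reachable_delete_edges_iff_exists_cycle.1
    ⟨hG, (hH v w).mono hle⟩
  exact ⟨u, p, hp, p.fst_mem_support_of_mem_edges hmem⟩

theorem IsPendant.adj_of_connected {V : Type*} {G H : SimpleGraph V} (hHG : H ≤ G)
    (hH : H.Connected) {u v : V} (hu : IsPendant G u) (huv : G.Adj u v) : H.Adj u v := by
  obtain ⟨p⟩ := hH u v
  cases p with
  | nil => exact (huv.ne rfl).elim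
  | cons h _ => exact hu.unique (hHG h) huv ▸ h

/-- In a connected sputnik graph, every maximal independent set is robust. -/
theorem stmt_2 {V : Type*} (G : SimpleGraph V) (hconn : G.Connected) (hsput : IsSputnik G)
    (M : Set V) (hM : IsMIS G M) : IsRobustMIS G M := by
  refine ⟨hM, fun H hHG hH => ?_⟩
  obtain ⟨hind, hdom⟩ := isMIS_iff.1 hM
  refine isMIS_iff.2 ⟨fun a ha b hb hab => hind ha hb (hHG hab), fun v hv => ?_⟩
  obtain ⟨w, hw, hvw⟩ := hdom v hv
  by_cases hHvw : H.Adj v w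
  · exact ⟨w, hw, hHvw⟩
  obtain ⟨u, hvu, hu⟩ := hsput v (onCycle_of_adj_of_not_adj hHG hH hvw hHvw)
  refine ⟨u, ?_, (hu.adj_of_connected hHG hH hvu.symm).symm⟩
  by_contra huM
  obtain ⟨x, hx, hux⟩ := hdom u huM
  exact hv (hu.unique hvu.symm hux ▸ hx)
end

section
/- Let G be a connected simple graph that is not a sputnik (i.e., some vertex of G lies on a cycle and has no pendant neighbor). If every maximal independent set of G is robust, then G is complete bipartite. -/
section

variable {V : Type*} {G : SimpleGraph V}

/-- An independent subset of `T` extends to an independent subset of `T` dominating `T`. -/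
lemma IsIndep.exists_dominating {S T : Set V} (hS : IsIndep G S) (hST : S ⊆ T) :
    ∃ J, S ⊆ J ∧ J ⊆ T ∧ IsIndep G J ∧ ∀ d ∈ T, d ∉ J → ∃ m ∈ J, G.Adj d m := by
  obtain ⟨J, hSJ, hJ⟩ := zorn_subset_nonempty {J | J ⊆ T ∧ IsIndep G J} (by
    intro c hc hchain _
    refine ⟨⋃₀ c, ⟨Set.sUnion_subset fun s hs => (hc hs).1, ?_⟩,
      fun s hs => Set.subset_sUnion_of_mem hs⟩
    rintro u ⟨s, hs, hus⟩ w ⟨t, ht, hwt⟩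
    rcases hchain.total hs ht with h | h
    · exact (hc ht).2 (h hus) hwt
    · exact (hc hs).2 hus (h hwt)) S ⟨hST, hS⟩
  refine ⟨J, hSJ, hJ.prop.1, hJ.prop.2, fun d hd hdJ => ?_⟩
  by_contra! hcon
  refine hdJ (hJ.le_of_ge (y := insert d J) ⟨Set.insert_subset hd hJ.prop.1, ?_⟩
    (Set.subset_insert d J) (Set.mem_insert d J))
  rintro u (rfl | hu) w (rfl | hw)
  · exact G.irrefl
  · exact hcon w hw
  · exact fun h => hcon u hu h.symm
  · exact hJ.prop.2 hu hw

lemma SimpleGraph.Walk.exists_reachable_neighbor {H : SimpleGraph V} {u v : V} (p : H.Walk u v)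
    (huv : u ≠ v) : ∃ z, H.Adj z v ∧ (H.deleteIncidenceSet v).Reachable u z := by
  induction p with
  | nil => exact absurd rfl huv
  | @cons a b c hab p ih =>
    by_cases hbc : b = c
    · exact ⟨a, hbc ▸ hab, .refl a⟩
    · obtain ⟨z, hz, hr⟩ := ih hbc
      have : (H.deleteIncidenceSet c).Adj a b :=
        SimpleGraph.deleteIncidenceSet_adj.2 ⟨hab, huv, hbc⟩
      exact ⟨z, hz, this.reachable.trans hr⟩

lemma OnCycle.exists_neighbors {v : V} (h : OnCycle G v) :
    ∃ a b, a ≠ b ∧ G.Adj v a ∧ G.Adj v b ∧ (G.deleteIncidenceSet v).Reachable a b := by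
  classical
  obtain ⟨u, w, hw, hv⟩ := h
  have hc := hw.rotate hv
  generalize w.rotate v hv = c at hc
  cases c with
  | nil => exact absurd hc SimpleGraph.Walk.not_isCycle_nil
  | @cons _ a _ hva p =>
    have hp := (SimpleGraph.Walk.cons_isCycle_iff p hva).1 hc
    obtain ⟨z, hz, hr⟩ := (p.toDeleteEdge s(v, a) hp.2).exists_reachable_neighbor hva.ne'
    rw [SimpleGraph.deleteEdges_adj] at hz
    refine ⟨a, z, ?_, hva, hz.1.symm, hr.mono ?_⟩
    · rintro rfl
      exact hz.2 Sym2.eq_swap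
    · intro p q hpq
      rw [SimpleGraph.deleteIncidenceSet_adj, SimpleGraph.deleteEdges_adj] at hpq
      exact SimpleGraph.deleteIncidenceSet_adj.2 ⟨hpq.1.1, hpq.2⟩

/-- If `v ∉ M` and every neighbor of `v` in `M` can be joined to a neighbor of `v` outside `M`
while avoiding `v`, then `M` is not robust. -/
lemma IsRobustMIS.false_of_reachable (hconn : G.Connected) {M : Set V} (hM : IsRobustMIS G M)
    {v : V} (hv : v ∉ M)
    (h : ∀ z ∈ M, G.Adj v z →
      ∃ z', G.Adj v z' ∧ z' ∉ M ∧ (G.deleteIncidenceSet v).Reachable z z') : False := by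
  let H : SimpleGraph V :=
    { Adj := fun p q => G.Adj p q ∧ ¬ (p = v ∧ q ∈ M) ∧ ¬ (q = v ∧ p ∈ M)
      symm := ⟨fun _ _ hpq => ⟨hpq.1.symm, hpq.2.2, hpq.2.1⟩⟩
      loopless := ⟨fun _ hp => G.irrefl hp.1⟩ }
  have hle : G.deleteIncidenceSet v ≤ H := by
    intro p q hpq
    rw [SimpleGraph.deleteIncidenceSet_adj] at hpq
    exact ⟨hpq.1, fun h => hpq.2.1 h.1, fun h => hpq.2.2 h.1⟩
  have hnb : ∀ z, G.Adj v z → z ∉ M → H.Reachable z v := fun z hz hzM =>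
    SimpleGraph.Adj.reachable (G := H) ⟨hz.symm, fun h => hv h.2, fun h => hzM h.2⟩
  have hreach : ∀ p, H.Reachable p v := by
    intro p
    by_cases hp : p = v
    · rw [hp]
    obtain ⟨q⟩ := hconn.preconnected p v
    obtain ⟨z, hz, hr⟩ := q.exists_reachable_neighbor hp
    refine (hr.mono hle).trans ?_
    by_cases hzM : z ∈ M
    · obtain ⟨z', hz', hz'M, hr'⟩ := h z hzM hz.symm
      exact (hr'.mono hle).trans (hnb z' hz' hz'M)
    · exact hnb z hz.symm hzM
  have hH : H.Connected :=
    { preconnected := fun p q => (hreach p).trans (hreach q).symm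
      nonempty := ⟨v⟩ }
  obtain ⟨hind, hmax⟩ := hM.2 H (fun _ _ hpq => hpq.1) hH
  refine hv (hmax (insert v M) ?_ (Set.subset_insert v M) ▸ Set.mem_insert v M)
  rintro p (rfl | hp) q (rfl | hq) hpq
  · exact G.irrefl hpq.1
  · exact hpq.2.1 ⟨rfl, hq⟩
  · exact hpq.2.2 ⟨rfl, hp⟩
  · exact hind hp hq hpq

lemma false_of_forall_robust (hconn : G.Connected)
    (hall : ∀ M : Set V, IsMIS G M → IsRobustMIS G M) {v : V}
    (hv : ∀ z, G.Adj v z → ∃ d, d ≠ v ∧ G.Adj z d) {x y w : V} (hx : G.Adj v x) (hy : G.Adj v y)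
    (hxy : (G.deleteIncidenceSet v).Reachable x y) (hyw : G.Adj y w)
    (hw : w = x ∨ w ≠ v ∧ ¬ G.Adj v w ∧ ¬ G.Adj w x) : False := by
  have hind : IsIndep G {x, w} := by
    have hwx : ¬ G.Adj w x := by
      rcases hw with rfl | hw
      · exact G.irrefl
      · exact hw.2.2
    rintro p (rfl | rfl) q (rfl | rfl)
    · exact G.irrefl
    · exact fun h => hwx h.symm
    · exact hwx
    · exact G.irrefl
  have hsub : ({x, w} : Set V) ⊆
      {d | d = x ∨ d ≠ v ∧ ¬ G.Adj v d ∧ ∃ z, G.Adj v z ∧ G.Adj z d} := by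
    rintro p (rfl | rfl)
    · exact Or.inl rfl
    · exact hw.imp id fun h => ⟨h.1, h.2.1, y, hy, hyw⟩
  obtain ⟨J, hSJ, hJT, hJ, hJdom⟩ := hind.exists_dominating hsub
  obtain ⟨M, hJM, -, hM, hMdom⟩ := hJ.exists_dominating (Set.subset_univ J)
  have hMIS : IsMIS G M := by
    refine ⟨hM, fun S hS hMS => (Set.Subset.antisymm hMS fun d hd => ?_).symm⟩
    by_contra hdM
    obtain ⟨m, hm, hdm⟩ := hMdom d (Set.mem_univ d) hdM
    exact hS hd (hMS hm) hdm
  have hxM : x ∈ M := hJM (hSJ (Or.inl rfl))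
  have hyM : y ∉ M := fun h => hM h (hJM (hSJ (Or.inr rfl))) hyw
  have step : ∀ {p q}, G.Adj p q → p ≠ v → q ≠ v → (G.deleteIncidenceSet v).Reachable p q :=
    fun h hp hq => SimpleGraph.Adj.reachable (SimpleGraph.deleteIncidenceSet_adj.2 ⟨h, hp, hq⟩)
  refine (hall M hMIS).false_of_reachable hconn (v := v) (fun h => hM h hxM hx) fun z hzM hz => ?_
  obtain ⟨d, hdv, hzd⟩ := hv z hz
  have hdM : d ∉ M := fun h => hM hzM h hzd
  have hrd := step hzd hz.ne' hdv
  by_cases hvd : G.Adj v d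
  · exact ⟨d, hvd, hdM, hrd⟩
  obtain ⟨m, hm, hdm⟩ := hJdom d (Or.inr ⟨hdv, hvd, z, hz, hzd⟩) fun h => hdM (hJM h)
  rcases hJT hm with rfl | ⟨hmv, -, z', hz', hz'm⟩
  · exact ⟨y, hy, hyM, hrd.trans ((step hdm hdv hx.ne').trans hxy)⟩
  · exact ⟨z', hz', fun h => hM h (hJM hm) hz'm,
      hrd.trans ((step hdm hdv hmv).trans (step hz'm.symm hmv hz'.ne'))⟩

lemma not_adj_of_forall_robust (hconn : G.Connected)
    (hall : ∀ M : Set V, IsMIS G M → IsRobustMIS G M) {v : V}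
    (hv : ∀ z, G.Adj v z → ∃ d, d ≠ v ∧ G.Adj z d) {x y : V}
    (hx : G.Adj v x) (hy : G.Adj v y) : ¬ G.Adj x y := fun hxy =>
  false_of_forall_robust hconn hall hv hx hy
    (SimpleGraph.Adj.reachable (SimpleGraph.deleteIncidenceSet_adj.2 ⟨hxy, hx.ne', hy.ne'⟩))
    hxy.symm (Or.inl rfl)

lemma adj_of_forall_robust (hconn : G.Connected)
    (hall : ∀ M : Set V, IsMIS G M → IsRobustMIS G M) {v : V}
    (hv : ∀ z, G.Adj v z → ∃ d, d ≠ v ∧ G.Adj z d) {x y w : V} (hx : G.Adj v x) (hy : G.Adj v y)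
    (hxy : (G.deleteIncidenceSet v).Reachable x y) (hyw : G.Adj y w) : G.Adj w x := by
  by_cases hwv : w = v
  · exact hwv ▸ hx
  by_contra hwx
  refine false_of_forall_robust hconn hall hv hx hy hxy hyw (Or.inr ⟨hwv, fun hvw => ?_, hwx⟩)
  exact not_adj_of_forall_robust hconn hall hv hvw hy hyw.symm

end

/-- If a connected graph `G` is not a sputnik and every MIS of `G` is robust,
then `G` is complete bipartite. -/
theorem stmt_3 {V : Type*} (G : SimpleGraph V) (hconn : G.Connected)
    (hnsput : ¬ IsSputnik G)
    (hall : ∀ M : Set V, IsMIS G M → IsRobustMIS G M) :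
    IsCompleteBipartite G := by
  obtain ⟨v, hcyc, hnp⟩ : ∃ v, OnCycle G v ∧ ∀ u, G.Adj v u → ¬ IsPendant G u := by
    by_contra! hcon
    exact hnsput hcon
  have hv : ∀ z, G.Adj v z → ∃ d, d ≠ v ∧ G.Adj z d := by
    intro z hz
    by_contra! hcon
    exact hnp z hz ⟨v, hz.symm, fun d hd => by_contra fun hdv => hcon d hdv hd⟩
  have step : ∀ {c p q}, G.Adj p q → p ≠ c → q ≠ c → (G.deleteIncidenceSet c).Reachable p q :=
    fun h hp hq => SimpleGraph.Adj.reachable (SimpleGraph.deleteIncidenceSet_adj.2 ⟨h, hp, hq⟩)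
  obtain ⟨a, a', hne, ha, ha', haa'⟩ := hcyc.exists_neighbors
  have hua' : ∀ u, G.Adj a u → G.Adj u a' := fun u hu =>
    adj_of_forall_robust hconn hall hv ha' ha haa'.symm hu
  have hva : ∀ z, G.Adj a z → ∃ d, d ≠ a ∧ G.Adj z d := fun z hz => ⟨a', hne.symm, hua' z hz⟩
  have htwin : ∀ {u u' c}, G.Adj a u → G.Adj a u' → G.Adj u c → G.Adj u' c :=
    fun {u u' c} hu hu' hc => (adj_of_forall_robust hconn hall hva hu' hu
      ((step (hua' u' hu') hu'.ne' hne.symm).trans (step (hua' u hu).symm hne.symm hu.ne')) hc).symm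
  obtain ⟨b, hbv, hab⟩ := hv a ha
  have hreach : ∀ c, G.Adj v c → (G.deleteIncidenceSet v).Reachable a c := fun c hc =>
    (step hab ha.ne' hbv).trans (step (htwin ha.symm hab hc) hbv hc.ne')
  have h₁ : ∀ {u c}, G.Adj a u → (G.Adj u c ↔ G.Adj v c) := fun hu =>
    ⟨htwin hu ha.symm, htwin ha.symm hu⟩
  have h₂ : ∀ {c u}, G.Adj v c → (G.Adj c u ↔ G.Adj a u) := fun {c u} hc =>
    ⟨fun h => (adj_of_forall_robust hconn hall hv ha hc (hreach c hc) h).symm,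
      fun h => (adj_of_forall_robust hconn hall hv hc ha (hreach c hc).symm h).symm⟩
  have hwalk : ∀ {p t}, G.Walk p t → G.Adj a t ∨ G.Adj v t → G.Adj a p ∨ G.Adj v p := by
    intro p t q ht
    induction q with
    | nil => exact ht
    | cons hpq _ ih =>
      rcases ih ht with h | h
      · exact Or.inr ((h₁ h).1 hpq.symm)
      · exact Or.inl ((h₂ h).1 hpq.symm)
  have hcover : ∀ p, G.Adj a p ∨ G.Adj v p := fun p =>
    hwalk (hconn.preconnected p a).some (Or.inr ha)
  have hdisj : ∀ p, G.Adj a p → ¬ G.Adj v p := fun p hap hvp =>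
    not_adj_of_forall_robust hconn hall hv ha hvp hap
  refine ⟨{p | G.Adj a p}, {p | G.Adj v p}, ⟨v, ha.symm⟩, ⟨a, ha⟩, ?_, ?_, fun p q => ?_⟩
  · exact Set.eq_empty_of_forall_notMem fun p hp => hdisj p hp.1 hp.2
  · exact Set.eq_univ_of_forall hcover
  · simp only [Set.mem_ofPred_eq]
    rcases hcover p with hp | hp
    · have := hdisj p hp
      have := h₁ (c := q) hp
      tauto
    · have : ¬ G.Adj a p := fun h => hdisj p h hp
      have := h₂ (u := q) hp
      tauto
end

section
/- Let G be a connected simple graph. Every maximal independent set of G is robust if and only if G is complete bipartite or G is a sputnik. -/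
theorem IsMIS.exists_adj {V : Type*} {G : SimpleGraph V} {M : Set V} (hM : IsMIS G M) {v : V}
    (hv : v ∉ M) : ∃ u ∈ M, G.Adj v u := by
  by_contra! h
  refine hv (hM.2 (insert v M) ?_ (Set.subset_insert v M) ▸ Set.mem_insert v M)
  rintro x (rfl | hx) y (rfl | hy)
  · exact G.loopless.irrefl _
  · exact h y hy
  · exact fun hxy => h x hx hxy.symm
  · exact hM.1 hx hy

theorem isMIS_of_exists_adj {V : Type*} {G : SimpleGraph V} {M : Set V} (hI : IsIndep G M)
    (hM : ∀ v ∉ M, ∃ u ∈ M, G.Adj v u) : IsMIS G M := by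
  refine ⟨hI, fun S hS hMS => Set.Subset.antisymm (fun v hv => ?_) hMS⟩
  by_contra hvM
  obtain ⟨u, hu, huv⟩ := hM v hvM
  exact hS hv (hMS hu) huv

theorem IsIndep.exists_isMIS {V : Type*} {G : SimpleGraph V} {I : Set V} (hI : IsIndep G I) :
    ∃ M, I ⊆ M ∧ IsMIS G M := by
  obtain ⟨M, hIM, hM⟩ := zorn_subset_nonempty {S : Set V | IsIndep G S} (by
    intro c hc hchain hne
    refine ⟨⋃₀ c, ?_, fun s hs => Set.subset_sUnion_of_mem hs⟩
    rintro u ⟨s, hs, hus⟩ v ⟨t, ht, hvt⟩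
    rcases hchain.total hs ht with h | h
    · exact hc ht (h hus) hvt
    · exact hc hs hus (h hvt)) I hI
  exact ⟨M, hIM, hM.prop, fun S hS hMS => Set.Subset.antisymm (hM.2 hS hMS) hMS⟩

theorem connected_of_adj_reachable {V : Type*} {G H : SimpleGraph V} (hG : G.Connected)
    (h : ∀ x y, G.Adj x y → H.Reachable x y) : H.Connected := by
  have := hG.nonempty
  refine ⟨fun x y => ?_⟩
  obtain ⟨p⟩ := hG.preconnected x y
  induction p with
  | nil => exact .rfl
  | cons e _ ih => exact (h _ _ e).trans ih

/-- If a robust MIS avoids `v`, then it contains all the neighbors of `v` in some component of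
`G - v`. -/
theorem IsRobustMIS.exists_neighbors_subset {V : Type*} {G : SimpleGraph V} (hconn : G.Connected)
    {M : Set V} (hM : IsRobustMIS G M) {v : V} (hv : v ∉ M) :
    ∃ u, G.Adj v u ∧
      ∀ u', G.Adj v u' → (G.deleteIncidenceSet v).Reachable u u' → u' ∈ M := by
  by_contra! h
  let H : SimpleGraph V :=
    { Adj := fun x y => G.Adj x y ∧ ¬ (x = v ∧ y ∈ M) ∧ ¬ (y = v ∧ x ∈ M)
      symm := ⟨fun x y hxy => ⟨hxy.1.symm, hxy.2.2, hxy.2.1⟩⟩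
      loopless := ⟨fun x hx => G.loopless.irrefl x hx.1⟩ }
  have hle : G.deleteIncidenceSet v ≤ H := by
    intro x y hxy
    rw [SimpleGraph.deleteIncidenceSet_adj] at hxy
    exact ⟨hxy.1, fun h => hxy.2.1 h.1, fun h => hxy.2.2 h.1⟩
  have hnb : ∀ u, G.Adj v u → H.Reachable v u := by
    intro u hu
    obtain ⟨u', hu', hr, hM'⟩ := h u hu
    have hvu' : H.Adj v u' := ⟨hu', fun h => hM' h.2, fun h => hv h.2⟩
    exact hvu'.reachable.trans (hr.mono hle).symm
  have hH : H.Connected := by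
    refine connected_of_adj_reachable hconn fun x y hxy => ?_
    by_cases hx : x = v
    · subst hx
      exact hnb y hxy
    by_cases hy : y = v
    · subst hy
      exact (hnb x hxy.symm).symm
    · exact SimpleGraph.Adj.reachable ⟨hxy, fun h => hx h.1, fun h => hy h.1⟩
  obtain ⟨u, hu, huv⟩ := (hM.2 H (fun _ _ h => h.1) hH).exists_adj hv
  exact huv.2.1 ⟨rfl, hu⟩

/-- If every MIS is robust and `v` has no pendant neighbor, neighbors of `v` in the same component
of `G - v` have the same neighbors. -/
theorem adj_of_reachable_deleteIncidenceSet {V : Type*} {G : SimpleGraph V} (hconn : G.Connected)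
    (hrob : ∀ M : Set V, IsMIS G M → IsRobustMIS G M) {v : V}
    (hpend : ∀ u, G.Adj v u → ¬ IsPendant G u) {a a' w : V} (ha : G.Adj v a) (ha' : G.Adj v a')
    (haa' : (G.deleteIncidenceSet v).Reachable a a') (hw : G.Adj a' w) : G.Adj a w := by
  by_cases hwv : w = v
  · exact hwv ▸ ha.symm
  by_contra hna
  set D := G.deleteIncidenceSet v
  have hDadj : ∀ {x y}, G.Adj x y → x ≠ v → y ≠ v → D.Reachable x y := fun h hx hy =>
    SimpleGraph.Adj.reachable ((SimpleGraph.deleteIncidenceSet_adj).2 ⟨h, hx, hy⟩)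
  have hY : ∀ c : D.ConnectedComponent, ∃ y, (∃ u, G.Adj v u ∧ D.connectedComponentMk u = c) →
      y ≠ v ∧ D.connectedComponentMk y = c ∧
        ∃ u, G.Adj v u ∧ D.connectedComponentMk u = c ∧ G.Adj u y := by
    intro c
    by_cases hc : ∃ u, G.Adj v u ∧ D.connectedComponentMk u = c
    · obtain ⟨u, hu, rfl⟩ := hc
      have : ∃ y, G.Adj u y ∧ y ≠ v := by
        by_contra! h
        exact hpend u hu ⟨v, hu.symm, fun y hy => h y hy⟩
      obtain ⟨y, huy, hyv⟩ := this
      exact ⟨y, fun _ => ⟨hyv, SimpleGraph.ConnectedComponent.eq.2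
        (hDadj huy hu.ne' hyv).symm, u, hu, rfl, huy⟩⟩
    · exact ⟨v, fun h => absurd h hc⟩
  choose Y hY using hY
  let I : Set V := {z | z = w ∨ z = a ∨ ∃ c, c ≠ D.connectedComponentMk a ∧
    (∃ u, G.Adj v u ∧ D.connectedComponentMk u = c) ∧ z = Y c}
  have hwa : D.connectedComponentMk w = D.connectedComponentMk a :=
    SimpleGraph.ConnectedComponent.eq.2 ((hDadj hw ha'.ne' hwv).symm.trans haa'.symm)
  have hIv : ∀ z ∈ I, z ≠ v := by
    rintro z (rfl | rfl | ⟨c, -, hc, rfl⟩)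
    · exact hwv
    · exact ha.ne'
    · exact (hY c hc).1
  have hI : IsIndep G I := by
    intro x hx y hy hxy
    have hcomp := SimpleGraph.ConnectedComponent.eq.2 (hDadj hxy (hIv x hx) (hIv y hy))
    have hna' : ¬ G.Adj w a := fun h => hna h.symm
    rcases hx with rfl | rfl | ⟨c, hca, hc, rfl⟩ <;>
      rcases hy with rfl | rfl | ⟨d, hda, hd, rfl⟩
    · exact G.loopless.irrefl _ hxy
    · exact hna' hxy
    · exact hda ((hY d hd).2.1 ▸ hcomp ▸ hwa)
    · exact hna hxy
    · exact G.loopless.irrefl _ hxy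
    · exact hda ((hY d hd).2.1 ▸ hcomp.symm)
    · exact hca ((hY c hc).2.1 ▸ hcomp ▸ hwa)
    · exact hca ((hY c hc).2.1 ▸ hcomp)
    · have : c = d := (hY c hc).2.1 ▸ (hY d hd).2.1 ▸ hcomp
      subst this
      exact G.loopless.irrefl _ hxy
  obtain ⟨M, hIM, hM⟩ := hI.exists_isMIS
  have hvM : v ∉ M := fun h => hM.1 h (hIM (Or.inr (Or.inl rfl))) ha
  obtain ⟨u, hu, huM⟩ := (hrob M hM).exists_neighbors_subset hconn hvM
  by_cases hua : D.connectedComponentMk u = D.connectedComponentMk a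
  · exact hM.1 (huM a' ha' ((SimpleGraph.ConnectedComponent.eq.1 hua).trans haa'))
      (hIM (Or.inl rfl)) hw
  · obtain ⟨-, -, u', hu', hcomp, hadj⟩ := hY _ ⟨u, hu, rfl⟩
    exact hM.1 (huM u' hu' (SimpleGraph.ConnectedComponent.eq.1 hcomp.symm))
      (hIM (Or.inr (Or.inr ⟨_, hua, ⟨u, hu, rfl⟩, rfl⟩))) hadj

theorem OnCycle.exists_neighbors_reachable {V : Type*} {G : SimpleGraph V} {v : V}
    (h : OnCycle G v) : ∃ a a', a ≠ a' ∧ G.Adj v a ∧ G.Adj v a' ∧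
      (G.deleteIncidenceSet v).Reachable a a' := by
  classical
  obtain ⟨u, w, hw, hv⟩ := h
  have hc := hw.rotate hv
  generalize w.rotate v hv = c at hc
  cases c with
  | nil => exact absurd rfl hc.ne_nil
  | @cons _ a _ e p =>
    rw [SimpleGraph.Walk.cons_isCycle_iff] at hc
    obtain ⟨hp, he⟩ := hc
    rw [← SimpleGraph.Walk.isPath_reverse_iff] at hp
    replace he : s(v, a) ∉ p.reverse.edges := by simpa using he
    generalize p.reverse = q at hp he
    cases q with
    | nil => exact absurd rfl e.ne
    | @cons _ a' _ e' q =>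
      rw [SimpleGraph.Walk.cons_isPath_iff] at hp
      refine ⟨a, a', ?_, e, e', ?_⟩
      · rintro rfl
        simp at he
      · have hq : ∀ e ∈ q.edges, e ∈ (G.deleteIncidenceSet v).edgeSet := by
          refine fun d => Sym2.ind (fun x y hxy => ?_) d
          rw [SimpleGraph.mem_edgeSet, SimpleGraph.deleteIncidenceSet_adj]
          refine ⟨q.adj_of_mem_edges hxy, ?_, ?_⟩
          · rintro rfl
            exact hp.2 (q.fst_mem_support_of_mem_edges hxy)
          · rintro rfl
            exact hp.2 (q.snd_mem_support_of_mem_edges hxy)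
        exact ⟨(q.transfer _ hq).reverse⟩

theorem onCycle_of_connected_of_not_adj {V : Type*} {G H : SimpleGraph V} (hHG : H ≤ G)
    (hH : H.Connected) {v u : V} (hG : G.Adj v u) (hnH : ¬ H.Adj v u) : OnCycle G v := by
  obtain ⟨p, hp⟩ := (hH.preconnected u v).exists_isPath
  refine ⟨v, .cons hG (p.mapLe hHG), ?_, SimpleGraph.Walk.start_mem_support _⟩
  rw [SimpleGraph.Walk.cons_isCycle_iff]
  refine ⟨hp.mapLe hHG, fun h => hnH ?_⟩
  rw [SimpleGraph.Walk.edges_mapLe_eq_edges] at h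
  exact p.adj_of_mem_edges h

theorem IsSputnik.isRobustMIS {V : Type*} {G : SimpleGraph V} (hG : IsSputnik G) {M : Set V}
    (hM : IsMIS G M) : IsRobustMIS G M := by
  refine ⟨hM, fun H hHG hH => isMIS_of_exists_adj
    (fun x hx y hy hxy => hM.1 hx hy (hHG hxy)) fun v hv => ?_⟩
  obtain ⟨u, hu, hvu⟩ := hM.exists_adj hv
  by_cases hHvu : H.Adj v u
  · exact ⟨u, hu, hHvu⟩
  obtain ⟨p, hvp, hp⟩ := hG v (onCycle_of_connected_of_not_adj hHG hH hvu hHvu)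
  refine ⟨p, ?_, ?_⟩
  · by_contra hpM
    obtain ⟨x, hx, hpx⟩ := hM.exists_adj hpM
    exact hv (hp.unique hvp.symm hpx ▸ hx)
  · have : Nontrivial V := ⟨v, p, hvp.ne⟩
    obtain ⟨x, hx⟩ := hH.preconnected.exists_adj_of_nontrivial p
    exact hp.unique hvp.symm (hHG hx) ▸ hx.symm

theorem IsCompleteBipartite.isRobustMIS {V : Type*} {G : SimpleGraph V}
    (hG : IsCompleteBipartite G) {M : Set V} (hM : IsMIS G M) : IsRobustMIS G M := by
  refine ⟨hM, fun H hHG hH => isMIS_of_exists_adj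
    (fun x hx y hy hxy => hM.1 hx hy (hHG hxy)) fun v hv => ?_⟩
  obtain ⟨u, hu, hvu⟩ := hM.exists_adj hv
  have : Nontrivial V := ⟨v, u, hvu.ne⟩
  obtain ⟨x, hx⟩ := hH.preconnected.exists_adj_of_nontrivial v
  refine ⟨x, ?_, hx⟩
  by_contra hxM
  obtain ⟨y, hy, hxy⟩ := hM.exists_adj hxM
  have huy := hM.1 hu hy
  have hvx := hHG hx
  obtain ⟨V1, V2, -, -, hdisj, -, hadj⟩ := hG
  have hd : ∀ z, z ∈ V1 → z ∈ V2 → False := fun z h1 h2 =>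
    (hdisj ▸ (⟨h1, h2⟩ : z ∈ V1 ∩ V2) : z ∈ (∅ : Set V))
  rw [hadj] at hvu hvx hxy huy
  have := hd v
  have := hd x
  tauto

theorem isCompleteBipartite_of_not_isSputnik {V : Type*} {G : SimpleGraph V}
    (hconn : G.Connected) (hrob : ∀ M : Set V, IsMIS G M → IsRobustMIS G M)
    (hG : ¬ IsSputnik G) : IsCompleteBipartite G := by
  unfold IsSputnik at hG
  push Not at hG
  obtain ⟨v, hcyc, hpend⟩ := hG
  obtain ⟨a, a', hne, ha, ha', hr⟩ := hcyc.exists_neighbors_reachable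
  have htwin : ∀ b, G.Adj v b → (G.deleteIncidenceSet v).Reachable a b →
      ∀ w, G.Adj b w ↔ G.Adj a w := fun b hb hab w =>
    ⟨adj_of_reachable_deleteIncidenceSet hconn hrob hpend ha hb hab,
      adj_of_reachable_deleteIncidenceSet hconn hrob hpend hb ha hab.symm⟩
  have hra : ∀ x, G.Adj a x → (G.deleteIncidenceSet a).Reachable a' x := fun x hx =>
    SimpleGraph.Adj.reachable ((SimpleGraph.deleteIncidenceSet_adj).2
      ⟨(htwin a' ha' hr x).2 hx, hne.symm, hx.ne'⟩)
  have hsub : ∀ M, IsMIS G M → a ∉ M → ∀ x, G.Adj a x → x ∈ M := by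
    intro M hM haM x hx
    obtain ⟨u, hu, huM⟩ := (hrob M hM).exists_neighbors_subset hconn haM
    exact huM x hx ((hra u hu).symm.trans (hra x hx))
  have hmono : ∀ w x z, G.Adj a w → G.Adj a x → G.Adj x z → G.Adj w z := by
    intro w x z hw hx hxz
    by_contra hwz
    have hI : IsIndep G {w, z} := by
      rintro p (rfl | rfl) q (rfl | rfl)
      · exact G.loopless.irrefl _
      · exact hwz
      · exact fun h => hwz h.symm
      · exact G.loopless.irrefl _
    obtain ⟨M, hIM, hM⟩ := hI.exists_isMIS
    have haM : a ∉ M := fun h => hM.1 h (hIM (Or.inl rfl)) hw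
    exact hM.1 (hsub M hM haM x hx) (hIM (Or.inr rfl)) hxz
  have hV1 : ∀ w, G.Adj a w → ∀ z, G.Adj w z ↔ G.Adj v z := fun w hw z =>
    ⟨hmono v w z ha.symm hw, hmono w v z hw ha.symm⟩
  have hdisj : ∀ x, G.Adj a x → ¬ G.Adj v x := fun x hx hvx =>
    G.loopless.irrefl x (hmono x v x hx ha.symm hvx)
  obtain ⟨w, haw, hwv⟩ : ∃ w, G.Adj a w ∧ w ≠ v := by
    by_contra! h
    exact hpend a ha ⟨v, ha.symm, fun y hy => h y hy⟩
  have hV2 : ∀ b, G.Adj v b → ∀ z, G.Adj b z ↔ G.Adj a z := by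
    intro b hb
    refine htwin b hb (SimpleGraph.Reachable.trans (v := w) ?_ ?_)
    · exact SimpleGraph.Adj.reachable ((SimpleGraph.deleteIncidenceSet_adj).2
        ⟨haw, ha.ne', hwv⟩)
    · exact SimpleGraph.Adj.reachable ((SimpleGraph.deleteIncidenceSet_adj).2
        ⟨(hV1 w haw b).2 hb, hwv, hb.ne'⟩)
  have huniv : ∀ x, G.Adj a x ∨ G.Adj v x := by
    intro x
    have hx : Relation.ReflTransGen G.Adj v x :=
      (SimpleGraph.reachable_iff_reflTransGen v x).1 (hconn.preconnected v x)
    induction hx with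
    | refl => exact Or.inl ha.symm
    | tail _ e ih =>
      rcases ih with h | h
      · exact Or.inr ((hV1 _ h _).1 e)
      · exact Or.inl ((hV2 _ h _).1 e)
  refine ⟨{x | G.Adj a x}, {x | G.Adj v x}, ⟨v, ha.symm⟩, ⟨a, ha⟩, ?_, ?_, fun x y => ?_⟩
  · exact Set.eq_empty_of_forall_notMem fun x hx => hdisj x hx.1 hx.2
  · exact Set.eq_univ_of_forall huniv
  · constructor
    · intro hxy
      rcases huniv x with h | h
      · exact Or.inl ⟨h, (hV1 x h y).1 hxy⟩
      · exact Or.inr ⟨h, (hV2 x h y).1 hxy⟩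
    · rintro (⟨hx, hy⟩ | ⟨hx, hy⟩)
      · exact (hV1 x hx y).2 hy
      · exact (hV2 x hx y).2 hy

/-- For a connected graph `G`, every MIS of `G` is robust iff `G` is complete
bipartite or a sputnik. -/
theorem stmt_4 {V : Type*} (G : SimpleGraph V) (hconn : G.Connected) :
    (∀ M : Set V, IsMIS G M → IsRobustMIS G M) ↔
      (IsCompleteBipartite G ∨ IsSputnik G) := by
  constructor
  · intro hrob
    by_cases hG : IsSputnik G
    · exact Or.inr hG
    · exact Or.inl (isCompleteBipartite_of_not_isSputnik hconn hrob hG)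
  · rintro (hG | hG) M hM
    · exact hG.isRobustMIS hM
    · exact hG.isRobustMIS hM
end

section
/- Let G be a connected simple graph and let M be a maximal independent set of G. Then M is robust if and only if for every vertex u not in M, deleting from G all edges joining u to vertices of M yields a disconnected graph. -/
theorem IsIndep.anti {V : Type*} {G H : SimpleGraph V} {M : Set V} (hHG : H ≤ G)
    (hM : IsIndep G M) : IsIndep H M :=
  fun _ hu _ hv huv => hM hu hv (hHG huv)

/-- A maximal independent set is the same thing as an independent dominating set. -/
theorem isMIS_iff_isIndep_and_forall_exists_adj {V : Type*} {G : SimpleGraph V} {M : Set V} :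
    IsMIS G M ↔ IsIndep G M ∧ ∀ u, u ∉ M → ∃ v ∈ M, G.Adj u v := by
  refine and_congr_right fun hM => ⟨fun hmax u hu => ?_, fun hdom S hS hMS => ?_⟩
  · by_contra! hno
    have hins : IsIndep G (insert u M) := by
      rintro a (rfl | ha) b (rfl | hb) hab
      · exact G.irrefl hab
      · exact hno b hb hab
      · exact hno a ha hab.symm
      · exact hM ha hb hab
    exact hu (hmax _ hins (Set.subset_insert u M) ▸ Set.mem_insert u M)
  · refine Set.Subset.antisymm (fun u hu => ?_) hMS
    by_contra huM
    obtain ⟨v, hv, huv⟩ := hdom u huM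
    exact hS hu (hMS hv) huv

/-- For a connected graph `G` and an MIS `M` of `G`, `M` is robust iff for
every vertex `u ∉ M`, deleting from `G` all edges joining `u` to vertices of `M` yields a
disconnected graph. -/
theorem stmt_7 {V : Type*} (G : SimpleGraph V) (hconn : G.Connected)
    (M : Set V) (hM : IsMIS G M) :
    IsRobustMIS G M ↔
      ∀ u, u ∉ M → ¬ (G.deleteEdges {e : Sym2 V | ∃ v ∈ M, e = s(u, v)}).Connected := by
  refine ⟨fun hrob u hu hdel => ?_, fun hcut => ⟨hM, fun H hHG hH => ?_⟩⟩
  · obtain ⟨v, hv, huv⟩ := (isMIS_iff_isIndep_and_forall_exists_adj.mp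
      (hrob.2 _ (G.deleteEdges_le _) hdel)).2 u hu
    exact (SimpleGraph.deleteEdges_adj.mp huv).2 ⟨v, hv, rfl⟩
  · refine isMIS_iff_isIndep_and_forall_exists_adj.mpr ⟨hM.1.anti hHG, fun u hu => ?_⟩
    by_contra! hno
    refine hcut u hu (hH.mono fun a b hab => SimpleGraph.deleteEdges_adj.mpr ⟨hHG hab, ?_⟩)
    rintro ⟨v, hv, he⟩
    rcases Sym2.eq_iff.mp he with ⟨rfl, rfl⟩ | ⟨rfl, rfl⟩
    · exact hno _ hv hab
    · exact hno _ hv hab.symm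
end

section
/- For every natural number k, the set M1 = {α_i, γ_i, b_i : 0 ≤ i ≤ k} is a robust maximal independent set of the graph G_k. -/
/-- Vertices of the graph `G_k`: six families `a_i, b_i, c_i, α_i, β_i, γ_i` for `0 ≤ i ≤ k`. -/
inductive GV (k : ℕ) : Type
  | a : Fin (k + 1) → GV k
  | b : Fin (k + 1) → GV k
  | c : Fin (k + 1) → GV k
  | al : Fin (k + 1) → GV k  -- α
  | be : Fin (k + 1) → GV k  -- β
  | ga : Fin (k + 1) → GV k  -- γ
  deriving DecidableEq

/-- Base relation generating the edges of `G_k`: the 6-cycle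
`a₀–b₀–c₀–γ₀–β₀–α₀–a₀` of `G₀`, and for each `1 ≤ i ≤ k` the edges
`{β_{i-1},α_i}, {β_{i-1},γ_i}, {α_i,β_i}, {γ_i,β_i}, {b_{i-1},a_i}, {b_{i-1},c_i},
{a_i,b_i}, {c_i,b_i}`. -/
def gkRel (k : ℕ) : GV k → GV k → Prop
  | GV.a i, GV.b j => i = j ∨ (i : ℕ) = (j : ℕ) + 1      -- a_i–b_i and b_{i-1}–a_i
  | GV.b i, GV.c j => i = j ∨ (j : ℕ) = (i : ℕ) + 1      -- b_i–c_i and b_{i-1}–c_i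
  | GV.al i, GV.be j => i = j ∨ (i : ℕ) = (j : ℕ) + 1    -- α_i–β_i and β_{i-1}–α_i
  | GV.be i, GV.ga j => i = j ∨ (j : ℕ) = (i : ℕ) + 1    -- β_i–γ_i and β_{i-1}–γ_i
  | GV.c i, GV.ga j => i = 0 ∧ j = 0                     -- c₀–γ₀
  | GV.al i, GV.a j => i = 0 ∧ j = 0                     -- α₀–a₀
  | _, _ => False

/-- The graph `G_k`. -/
def Gk (k : ℕ) : SimpleGraph (GV k) := SimpleGraph.fromRel (gkRel k)

/-- The set `M1 = {α_i, γ_i, b_i : 0 ≤ i ≤ k}`. -/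
def M1 (k : ℕ) : Set (GV k) :=
  {v | ∃ i : Fin (k + 1), v = GV.al i ∨ v = GV.ga i ∨ v = GV.b i}

/-- The set `M2 = {a_i, c_i, β_i : 0 ≤ i ≤ k}`. -/
def M2 (k : ℕ) : Set (GV k) :=
  {v | ∃ i : Fin (k + 1), v = GV.a i ∨ v = GV.c i ∨ v = GV.be i}

/-- Every edge of `G_k` has exactly one endpoint in `M1`. -/
theorem Gk_adj_mem_M1 {k : ℕ} {u v : GV k} (h : (Gk k).Adj u v) : u ∈ M1 k ↔ v ∉ M1 k := by
  rw [Gk, SimpleGraph.fromRel_adj] at h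
  cases u <;> cases v <;> simp_all [gkRel, M1]

theorem Gk_exists_adj {k : ℕ} (v : GV k) : ∃ w, (Gk k).Adj v w := by
  cases v with
  | a i => exact ⟨.b i, by simp [Gk, gkRel]⟩
  | b i => exact ⟨.a i, by simp [Gk, gkRel]⟩
  | c i => exact ⟨.b i, by simp [Gk, gkRel]⟩
  | al i => exact ⟨.be i, by simp [Gk, gkRel]⟩
  | be i => exact ⟨.al i, by simp [Gk, gkRel]⟩
  | ga i => exact ⟨.be i, by simp [Gk, gkRel]⟩

/-- In a graph without isolated vertices, each side of a bipartition is a maximal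
independent set. -/
theorem isMIS_of_bipartition {V : Type*} {H : SimpleGraph V} {M : Set V}
    (hM : ∀ ⦃u v⦄, H.Adj u v → (u ∈ M ↔ v ∉ M)) (hH : ∀ v, ∃ w, H.Adj v w) : IsMIS H M := by
  refine ⟨fun u hu v hv h => (hM h).1 hu hv, fun S hS hMS => ?_⟩
  refine Set.Subset.antisymm (fun v hv => ?_) hMS
  by_contra hvM
  obtain ⟨w, hw⟩ := hH v
  exact hS hv (hMS ((hM hw.symm).2 hvM)) hw

/-- For every `k`, `M1 = {α_i, γ_i, b_i : 0 ≤ i ≤ k}` is a robust MIS of `G_k`. -/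
theorem stmt_8 (k : ℕ) : IsRobustMIS (Gk k) (M1 k) := by
  refine ⟨isMIS_of_bipartition (fun _ _ => Gk_adj_mem_M1) Gk_exists_adj, fun H hHG hH => ?_⟩
  have : Nontrivial (GV k) := ⟨.a 0, .b 0, by simp⟩
  exact isMIS_of_bipartition (fun _ _ h => Gk_adj_mem_M1 (hHG h))
    fun v => hH.preconnected.exists_adj_of_nontrivial v
end

section
/- For every natural number k, the set M2 = {a_i, c_i, β_i : 0 ≤ i ≤ k}, which is the complement of M1 = {α_i, γ_i, b_i : 0 ≤ i ≤ k} in the vertex set of G_k, is a robust maximal independent set of the graph G_k. -/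
/-- If the complement of an independent set `M` has a neighbour in `M` at each of its vertices,
then `M` is a maximal independent set. -/
theorem isMIS_of_forall_exists_adj {V : Type*} {G : SimpleGraph V} {M : Set V}
    (hM : IsIndep G M) (hdom : ∀ v ∉ M, ∃ w ∈ M, G.Adj v w) : IsMIS G M := by
  refine ⟨hM, fun S hS hMS => Set.Subset.antisymm (fun v hv => ?_) hMS⟩
  by_contra hvM
  obtain ⟨w, hw, hvw⟩ := hdom v hvM
  exact hS hv (hMS hw) hvw

/-- A side of a bipartition is a maximal independent set of any spanning subgraph without
isolated vertices. -/
theorem isMIS_of_isIndep_compl {V : Type*} {G H : SimpleGraph V} {M : Set V}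
    (hM : IsIndep G M) (hMc : IsIndep G Mᶜ) (hHG : H ≤ G) (hH : ∀ v, ∃ w, H.Adj v w) :
    IsMIS H M := by
  refine isMIS_of_forall_exists_adj (fun u hu v hv h => hM hu hv (hHG h)) fun v hv => ?_
  obtain ⟨w, hvw⟩ := hH v
  exact ⟨w, by_contra fun hw => hMc hv hw (hHG hvw), hvw⟩

theorem M2_eq_compl_M1 (k : ℕ) : M2 k = (M1 k)ᶜ := by
  ext v
  cases v <;> simp [M1, M2]

theorem isIndep_Gk_M1 (k : ℕ) : IsIndep (Gk k) (M1 k) := by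
  rintro u ⟨i, rfl | rfl | rfl⟩ v ⟨j, rfl | rfl | rfl⟩ <;> simp [Gk, gkRel]

theorem isIndep_Gk_M2 (k : ℕ) : IsIndep (Gk k) (M2 k) := by
  rintro u ⟨i, rfl | rfl | rfl⟩ v ⟨j, rfl | rfl | rfl⟩ <;> simp [Gk, gkRel]

theorem exists_Gk_adj (k : ℕ) (v : GV k) : ∃ w, (Gk k).Adj v w := by
  cases v with
  | a i => exact ⟨GV.b i, by simp [Gk, gkRel]⟩
  | b i => exact ⟨GV.a i, by simp [Gk, gkRel]⟩
  | c i => exact ⟨GV.b i, by simp [Gk, gkRel]⟩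
  | al i => exact ⟨GV.be i, by simp [Gk, gkRel]⟩
  | be i => exact ⟨GV.al i, by simp [Gk, gkRel]⟩
  | ga i => exact ⟨GV.be i, by simp [Gk, gkRel]⟩

/-- For every `k`, `M2 = {a_i, c_i, β_i : 0 ≤ i ≤ k}` is the complement of `M1`
in the vertex set of `G_k`, and it is a robust MIS of `G_k`. -/
theorem stmt_9 (k : ℕ) : M2 k = (M1 k)ᶜ ∧ IsRobustMIS (Gk k) (M2 k) := by
  have hM1 : IsIndep (Gk k) (M2 k)ᶜ := by
    rw [M2_eq_compl_M1, compl_compl]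
    exact isIndep_Gk_M1 k
  have : Nontrivial (GV k) := ⟨GV.a 0, GV.b 0, by simp⟩
  refine ⟨M2_eq_compl_M1 k,
    isMIS_of_isIndep_compl (isIndep_Gk_M2 k) hM1 le_rfl (exists_Gk_adj k), fun H hHG hH => ?_⟩
  exact isMIS_of_isIndep_compl (isIndep_Gk_M2 k) hM1 hHG
    hH.preconnected.exists_adj_of_nontrivial
end

section
/- For every natural number k and every robust maximal independent set M of the graph G_k: if α_0 ∈ M, then γ_0 ∈ M and b_0 ∈ M, while β_0 ∉ M, c_0 ∉ M and a_0 ∉ M. -/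
theorem Gk_adj_iff {k : ℕ} {u v : GV k} : (Gk k).Adj u v ↔ gkRel k u v ∨ gkRel k v u := by
  rw [Gk, SimpleGraph.fromRel_adj, and_iff_right_iff_imp]
  rintro h rfl
  cases u <;> simp [gkRel] at h

/-- A graph on the vertices of `G_k` that keeps all edges except possibly `α₀–a₀` and `c₀–γ₀`,
and at least one of these two, is connected. -/
theorem connected_of_linking_edge {k : ℕ} {H : SimpleGraph (GV k)}
    (hH : ∀ u v, (Gk k).Adj u v → s(u, v) ≠ s(GV.al 0, GV.a 0) → s(u, v) ≠ s(GV.c 0, GV.ga 0) →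
      H.Adj u v)
    (hlink : H.Adj (GV.al 0) (GV.a 0) ∨ H.Adj (GV.c 0) (GV.ga 0)) : H.Connected := by
  have hab (i j : Fin (k + 1)) (h : i = j ∨ (i : ℕ) = j + 1) : H.Reachable (GV.a i) (GV.b j) :=
    (hH (GV.a i) (GV.b j) (Gk_adj_iff.2 (.inl h)) (by simp) (by simp)).reachable
  have hbc (i j : Fin (k + 1)) (h : i = j ∨ (j : ℕ) = i + 1) : H.Reachable (GV.b i) (GV.c j) :=
    (hH (GV.b i) (GV.c j) (Gk_adj_iff.2 (.inl h)) (by simp) (by simp)).reachable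
  have hαβ (i j : Fin (k + 1)) (h : i = j ∨ (i : ℕ) = j + 1) : H.Reachable (GV.al i) (GV.be j) :=
    (hH (GV.al i) (GV.be j) (Gk_adj_iff.2 (.inl h)) (by simp) (by simp)).reachable
  have hβγ (i j : Fin (k + 1)) (h : i = j ∨ (j : ℕ) = i + 1) : H.Reachable (GV.be i) (GV.ga j) :=
    (hH (GV.be i) (GV.ga j) (Gk_adj_iff.2 (.inl h)) (by simp) (by simp)).reachable
  have hb (i : Fin (k + 1)) : H.Reachable (GV.b i) (GV.b 0) := by
    induction i using Fin.induction with
    | zero => rfl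
    | succ i ih => exact ((hab _ _ (.inl rfl)).symm.trans (hab _ _ (.inr (by simp)))).trans ih
  have hβ (i : Fin (k + 1)) : H.Reachable (GV.be i) (GV.be 0) := by
    induction i using Fin.induction with
    | zero => rfl
    | succ i ih => exact ((hαβ _ _ (.inl rfl)).symm.trans (hαβ _ _ (.inr (by simp)))).trans ih
  have hβb : H.Reachable (GV.be 0) (GV.b 0) := by
    rcases hlink with h | h
    · exact ((hαβ 0 0 (.inl rfl)).symm.trans h.reachable).trans (hab 0 0 (.inl rfl))
    · exact ((hβγ 0 0 (.inl rfl)).trans h.symm.reachable).trans (hbc 0 0 (.inl rfl)).symm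
  rw [SimpleGraph.connected_iff_exists_forall_reachable]
  refine ⟨GV.b 0, fun v => SimpleGraph.Reachable.symm ?_⟩
  cases v with
  | a i => exact (hab i i (.inl rfl)).trans (hb i)
  | b i => exact hb i
  | c i => exact (hbc i i (.inl rfl)).symm.trans (hb i)
  | al i => exact ((hαβ i i (.inl rfl)).trans (hβ i)).trans hβb
  | be i => exact (hβ i).trans hβb
  | ga i => exact ((hβγ i i (.inl rfl)).symm.trans (hβ i)).trans hβb

/-- For every robust MIS `M` of `G_k`: if `α₀ ∈ M`, then `γ₀ ∈ M` and
`b₀ ∈ M`, while `β₀ ∉ M`, `c₀ ∉ M` and `a₀ ∉ M`. -/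
theorem stmt_12 (k : ℕ) (M : Set (GV k)) (hM : IsRobustMIS (Gk k) M)
    (h : GV.al (0 : Fin (k + 1)) ∈ M) :
    GV.ga (0 : Fin (k + 1)) ∈ M ∧ GV.b (0 : Fin (k + 1)) ∈ M ∧
      GV.be (0 : Fin (k + 1)) ∉ M ∧ GV.c (0 : Fin (k + 1)) ∉ M ∧
      GV.a (0 : Fin (k + 1)) ∉ M := by
  have hnot {u v : GV k} (hu : u ∈ M) (huv : gkRel k u v ∨ gkRel k v u) : v ∉ M :=
    fun hv => hM.1.1 hu hv (Gk_adj_iff.2 huv)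
  have hβ : GV.be 0 ∉ M := hnot h (.inl (.inl rfl))
  have ha : GV.a 0 ∉ M := hnot h (.inl ⟨rfl, rfl⟩)
  have hγ : GV.ga 0 ∈ M := by
    by_contra hγ
    have hconn : ((Gk k).deleteEdges {s(GV.c 0, GV.ga 0)}).Connected :=
      connected_of_linking_edge (by simp +contextual [SimpleGraph.deleteEdges_adj])
        (.inl (by simp [SimpleGraph.deleteEdges_adj, Gk_adj_iff, gkRel]))
    obtain ⟨u, hu, hadj⟩ := (hM.2 _ (SimpleGraph.deleteEdges_le _) hconn).exists_adj hγ
    rw [SimpleGraph.deleteEdges_adj, Gk_adj_iff] at hadj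
    cases u <;> simp_all [gkRel]
  have hb : GV.b 0 ∈ M := by
    have hconn : ((Gk k).deleteEdges {s(GV.al 0, GV.a 0)}).Connected :=
      connected_of_linking_edge (by simp +contextual [SimpleGraph.deleteEdges_adj])
        (.inr (by simp [SimpleGraph.deleteEdges_adj, Gk_adj_iff, gkRel]))
    obtain ⟨u, hu, hadj⟩ := (hM.2 _ (SimpleGraph.deleteEdges_le _) hconn).exists_adj ha
    rw [SimpleGraph.deleteEdges_adj, Gk_adj_iff] at hadj
    cases u <;> simp_all [gkRel]
  exact ⟨hγ, hb, hβ, hnot hγ (.inr ⟨rfl, rfl⟩), ha⟩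
end

section
/- For every natural number k and every robust maximal independent set M of the graph G_k: if α_0 ∈ M, then for every i with 0 ≤ i ≤ k one has α_i ∈ M, γ_i ∈ M and β_i ∉ M. -/
/-- In a maximal independent set, a vertex none of whose neighbours is a member is a member. -/
lemma IsMIS.mem_of_forall_adj_notMem {V : Type*} {G : SimpleGraph V} {M : Set V} (hM : IsMIS G M)
    {u : V} (hu : ∀ w, G.Adj u w → w ∉ M) : u ∈ M := by
  rw [← hM.2 (insert u M) ?_ (Set.subset_insert u M)]
  · exact Set.mem_insert u M
  · rintro x (rfl | hx) y (rfl | hy) hxy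
    · exact hxy.ne rfl
    · exact hu y hxy hy
    · exact hu x hxy.symm hx
    · exact hM.1 hx hy hxy

/-- Let `s(u, v)` be an edge of a connected graph whose endpoints stay connected without it. If no
neighbour of `u` other than `v` lies in a robust maximal independent set, then `u` does. -/
lemma IsRobustMIS.mem_of_reachable_deleteEdges {V : Type*} {G : SimpleGraph V} {M : Set V}
    (hM : IsRobustMIS G M) (hG : G.Connected) {u v : V}
    (huv : (G.deleteEdges {s(u, v)}).Reachable u v)
    (hu : ∀ w, G.Adj u w → w ≠ v → w ∉ M) : u ∈ M := by
  have hbridge : ¬ G.IsBridge s(u, v) := by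
    rw [SimpleGraph.isBridge_iff]
    intro h
    exact h huv
  refine (hM.2 _ (G.deleteEdges_le {s(u, v)})
    (hG.connected_delete_edge_of_not_isBridge hbridge)).mem_of_forall_adj_notMem ?_
  intro w hw
  rw [SimpleGraph.deleteEdges_adj] at hw
  refine hu w hw.1 ?_
  rintro rfl
  exact hw.2 rfl

lemma Gk_connected (k : ℕ) : (Gk k).Connected := by
  have key : ∀ n (hn : n < k + 1), ∀ v ∈ [GV.a ⟨n, hn⟩, GV.b ⟨n, hn⟩, GV.c ⟨n, hn⟩,
      GV.al ⟨n, hn⟩, GV.be ⟨n, hn⟩, GV.ga ⟨n, hn⟩], (Gk k).Reachable (GV.b 0) v := by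
    intro n
    induction n with
    | zero =>
      intro hn
      have ha : (Gk k).Reachable (GV.b 0) (GV.a 0) :=
        SimpleGraph.Adj.reachable (by simp [Gk, gkRel])
      have hc : (Gk k).Reachable (GV.b 0) (GV.c 0) :=
        SimpleGraph.Adj.reachable (by simp [Gk, gkRel])
      have hal := ha.trans (SimpleGraph.Adj.reachable (v := GV.al 0) (by simp [Gk, gkRel]))
      have hga := hc.trans (SimpleGraph.Adj.reachable (v := GV.ga 0) (by simp [Gk, gkRel]))
      have hbe := hal.trans (SimpleGraph.Adj.reachable (v := GV.be 0) (by simp [Gk, gkRel]))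
      simp [ha, hc, hal, hga, hbe]
    | succ n ih =>
      intro hn
      have hn' : n < k + 1 := by omega
      have hb := ih hn' (GV.b ⟨n, hn'⟩) (by simp)
      have hbe := ih hn' (GV.be ⟨n, hn'⟩) (by simp)
      have ha := hb.trans (SimpleGraph.Adj.reachable (v := GV.a ⟨n + 1, hn⟩) (by simp [Gk, gkRel]))
      have hc := hb.trans (SimpleGraph.Adj.reachable (v := GV.c ⟨n + 1, hn⟩) (by simp [Gk, gkRel]))
      have hb' := ha.trans (SimpleGraph.Adj.reachable (v := GV.b ⟨n + 1, hn⟩) (by simp [Gk, gkRel]))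
      have hal := hbe.trans
        (SimpleGraph.Adj.reachable (v := GV.al ⟨n + 1, hn⟩) (by simp [Gk, gkRel]))
      have hga := hbe.trans
        (SimpleGraph.Adj.reachable (v := GV.ga ⟨n + 1, hn⟩) (by simp [Gk, gkRel]))
      have hbe' := hal.trans
        (SimpleGraph.Adj.reachable (v := GV.be ⟨n + 1, hn⟩) (by simp [Gk, gkRel]))
      simp [ha, hc, hb', hal, hga, hbe']
  rw [SimpleGraph.connected_iff_exists_forall_reachable]
  refine ⟨GV.b 0, ?_⟩
  rintro (i | i | i | i | i | i) <;> exact key i i.2 _ (by simp)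

section Membership

variable {k : ℕ} {M : Set (GV k)}

lemma ga_zero_mem (hM : IsRobustMIS (Gk k) M) (hbe : GV.be 0 ∉ M) : GV.ga 0 ∈ M := by
  refine hM.mem_of_reachable_deleteEdges (Gk_connected k) (v := GV.c 0) ?_ ?_
  · refine (SimpleGraph.Adj.reachable (v := GV.be 0) ?_).trans <|
      (SimpleGraph.Adj.reachable (v := GV.al 0) ?_).trans <|
      (SimpleGraph.Adj.reachable (v := GV.a 0) ?_).trans <|
      (SimpleGraph.Adj.reachable (v := GV.b 0) ?_).trans (SimpleGraph.Adj.reachable ?_) <;>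
    simp [Gk, gkRel]
  · rintro (i | i | i | i | i | i) hw hne <;> simp [Gk, gkRel] at hw hne ⊢
    · exact absurd hw hne
    · rwa [hw]

lemma al_succ_mem (hM : IsRobustMIS (Gk k) M) {n : ℕ} (hn : n + 1 < k + 1)
    (hbe : GV.be ⟨n, by omega⟩ ∉ M) : GV.al ⟨n + 1, hn⟩ ∈ M := by
  refine hM.mem_of_reachable_deleteEdges (Gk_connected k) (v := GV.be ⟨n + 1, hn⟩) ?_ ?_
  · refine (SimpleGraph.Adj.reachable (v := GV.be ⟨n, by omega⟩) ?_).trans <|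
      (SimpleGraph.Adj.reachable (v := GV.ga ⟨n + 1, hn⟩) ?_).trans
        (SimpleGraph.Adj.reachable ?_) <;>
    simp [Gk, gkRel]
  · rintro (i | i | i | i | i | i) hw hne <;> simp [Gk, gkRel] at hw hne ⊢
    obtain rfl : i = ⟨n, by omega⟩ := by grind
    exact hbe

lemma ga_succ_mem (hM : IsRobustMIS (Gk k) M) {n : ℕ} (hn : n + 1 < k + 1)
    (hbe : GV.be ⟨n, by omega⟩ ∉ M) : GV.ga ⟨n + 1, hn⟩ ∈ M := by
  refine hM.mem_of_reachable_deleteEdges (Gk_connected k) (v := GV.be ⟨n + 1, hn⟩) ?_ ?_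
  · refine (SimpleGraph.Adj.reachable (v := GV.be ⟨n, by omega⟩) ?_).trans <|
      (SimpleGraph.Adj.reachable (v := GV.al ⟨n + 1, hn⟩) ?_).trans
        (SimpleGraph.Adj.reachable ?_) <;>
    simp [Gk, gkRel]
  · rintro (i | i | i | i | i | i) hw hne <;> simp [Gk, gkRel] at hw hne ⊢
    obtain rfl : i = ⟨n, by omega⟩ := by grind
    exact hbe

lemma be_notMem_of_al_mem (hM : IsIndep (Gk k) M) {i : Fin (k + 1)} (hal : GV.al i ∈ M) :
    GV.be i ∉ M :=
  fun hbe => hM hal hbe (by simp [Gk, gkRel])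

end Membership

/-- For every robust MIS `M` of `G_k`: if `α₀ ∈ M`, then for every
`0 ≤ i ≤ k`, `α_i ∈ M`, `γ_i ∈ M` and `β_i ∉ M`. -/
theorem stmt_13 (k : ℕ) (M : Set (GV k)) (hM : IsRobustMIS (Gk k) M)
    (h : GV.al (0 : Fin (k + 1)) ∈ M) :
    ∀ i : Fin (k + 1), GV.al i ∈ M ∧ GV.ga i ∈ M ∧ GV.be i ∉ M := by
  have hindep := hM.1.1
  rintro ⟨n, hn⟩
  induction n with
  | zero =>
    have hbe := be_notMem_of_al_mem hindep h
    exact ⟨h, ga_zero_mem hM hbe, hbe⟩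
  | succ n ih =>
    have hbe := (ih (by omega)).2.2
    have hal := al_succ_mem hM hn hbe
    exact ⟨hal, ga_succ_mem hM hn hbe, be_notMem_of_al_mem hindep hal⟩
end

section
/- Let G be a connected sputnik graph with at least 3 vertices. Let P be the set of pendant vertices of G, let N be the set of non-pendant vertices having at least one pendant neighbor, and let F be the set of remaining vertices (neither pendant nor adjacent to a pendant vertex). If M_F is a maximal independent set of the subgraph of G induced by F, then P ∪ M_F is a maximal independent set of G. -/
/-- A nonempty vertex set closed under adjacency in a connected graph contains every vertex. -/
theorem SimpleGraph.Connected.mem_of_adj_closed {V : Type*} {G : SimpleGraph V}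
    (hconn : G.Connected) {S : Set V} (hS : ∀ ⦃u v⦄, u ∈ S → G.Adj u v → v ∈ S) {a : V}
    (ha : a ∈ S) (b : V) : b ∈ S := by
  obtain ⟨w⟩ := hconn.preconnected a b
  induction w with
  | nil => exact ha
  | cons h _ ih => exact ih (hS ha h)

/-- In a connected graph with at least three vertices, no two pendant vertices are adjacent. -/
theorem IsPendant.not_adj {V : Type*} {G : SimpleGraph V} (hconn : G.Connected)
    (hcard : ∃ x y z : V, x ≠ y ∧ x ≠ z ∧ y ≠ z) {u v : V}
    (hu : IsPendant G u) (hv : IsPendant G v) : ¬ G.Adj u v := by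
  intro huv
  have hclosed : ∀ ⦃a b⦄, a ∈ ({u, v} : Set V) → G.Adj a b → b ∈ ({u, v} : Set V) := by
    rintro a b (rfl | rfl) hab
    · exact Or.inr (hu.unique hab huv)
    · exact Or.inl (hv.unique hab huv.symm)
  have hall (b : V) : b = u ∨ b = v :=
    hconn.mem_of_adj_closed hclosed (Set.mem_insert u {v}) b
  obtain ⟨x, y, z, hxy, hxz, hyz⟩ := hcard
  rcases hall x with hx | hx <;> rcases hall y with hy | hy <;> rcases hall z with hz | hz <;>
    simp_all

/-- Let `G` be a connected sputnik graph with at least 3 vertices, `P` the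
set of pendant vertices, `N` the set of non-pendant vertices with a pendant neighbor, and
`F` the set of remaining vertices. If `M_F` is an MIS of the subgraph of `G` induced by
`F`, then `P ∪ M_F` is an MIS of `G`. -/
theorem stmt_17 {V : Type*} (G : SimpleGraph V) (hconn : G.Connected) (hsput : IsSputnik G)
    (hcard : ∃ x y z : V, x ≠ y ∧ x ≠ z ∧ y ≠ z)
    (P N F : Set V)
    (hP : P = {v | IsPendant G v})
    (hN : N = {v | ¬ IsPendant G v ∧ ∃ u, G.Adj v u ∧ IsPendant G u})
    (hF : F = Set.univ \ (P ∪ N))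
    (MF : Set F) (hMF : IsMIS (G.induce F) MF) :
    IsMIS G (P ∪ (Subtype.val '' MF)) := by
  have hF_nadj : ∀ ⦃x y⦄, x ∈ F → y ∈ P → ¬ G.Adj x y := by
    intro x y hx hy hxy
    subst hF hN hP
    exact hx.2 (Or.inr ⟨fun h => hx.2 (Or.inl h), y, hxy, hy⟩)
  refine ⟨?_, fun S hS hsub => Set.Subset.antisymm (fun x hx => ?_) hsub⟩
  · rintro u (hu | ⟨u, hu, rfl⟩) v (hv | ⟨v, hv, rfl⟩) huv
    · subst hP
      exact IsPendant.not_adj hconn hcard hu hv huv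
    · exact hF_nadj v.2 hu huv.symm
    · exact hF_nadj u.2 hv huv
    · exact hMF.1 hu hv huv
  · by_cases hxP : x ∈ P
    · exact Or.inl hxP
    by_cases hxN : x ∈ N
    · subst hN hP
      obtain ⟨_, y, hxy, hy⟩ := hxN
      exact absurd hxy (hS hx (hsub (Or.inl hy)))
    have hxF : x ∈ F := hF ▸ ⟨trivial, fun h => h.elim hxP hxN⟩
    have hpre : Subtype.val ⁻¹' S = MF :=
      hMF.2 _ (fun a ha b hb hab => hS ha hb hab)
        (fun a ha => hsub (Or.inr ⟨a, ha, rfl⟩))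
    exact Or.inr ⟨⟨x, hxF⟩, hpre ▸ hx, rfl⟩
end
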